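/- arXiv:2207.10873 — 4 statements merged into one kernel-verified Lean document; each statement's English description precedes it below -/
import Mathlib

section
/- For all integers g ≥ 2 and n ≥ 1, the matrix M is invertible over ℚ, i.e., det M ≠ 0. (This is the linear-algebra core of the paper's proof that the divisor classes ψ_1,…,ψ_n and δ_{ij} are linearly independent on the partial compactification of the moduli space of n-pointed hyperelliptic curves of genus g.) -/
/-- The index type of unordered pairs `{i, j}` with `1 ≤ i < j ≤ n`, realized as
two-element subsets of `Fin n`. -/
abbrev PairIdx (n : ℕ) := {s : Finset (Fin n) // s.card = 2}

/-- The intersection matrix of the test curves `T_i`, `T_{ij}` against the divisor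
classes `ψ_j`, `δ_{jk}` on the partial compactification of the moduli space of
`n`-pointed hyperelliptic curves of genus `g`. -/
def intersectionMatrix (g : ℤ) (n : ℕ) :
    Matrix (Fin n ⊕ PairIdx n) (Fin n ⊕ PairIdx n) ℚ :=
  fun r c =>
    match r, c with
    | Sum.inl i, Sum.inl j => if i = j then 2 * (g : ℚ) + n - 3 else 1
    | Sum.inl i, Sum.inr s => if i ∈ s.val then 1 else 0
    | Sum.inr s, Sum.inl k => if k ∈ s.val then 4 * (g : ℚ) + n - 2 else 2
    | Sum.inr s, Sum.inr t =>
        if s = t then 2 * (g : ℚ) + 2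
        else if (s.val ∩ t.val).card = 1 then 1 else 0

/-- Summing over the pairs containing `i` is summing over the other element of the pair. -/
theorem sum_pairIdx_ite_mem {R : Type*} [AddCommMonoid R] {n : ℕ} (i : Fin n)
    (f : Finset (Fin n) → R) :
    ∑ s : PairIdx n, (if i ∈ s.val then f s.val else 0) =
      ∑ j ∈ Finset.univ.erase i, f {i, j} := by
  rw [← Finset.sum_filter]
  symm
  refine Finset.sum_bij
    (fun j hj => ⟨{i, j}, Finset.card_pair (Finset.ne_of_mem_erase hj).symm⟩) ?_ ?_ ?_ ?_
  · intro j hj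
    simp
  · intro j hj k hk h
    have hpair : ({i, j} : Finset (Fin n)) = {i, k} := congrArg Subtype.val h
    have hmem : j ∈ ({i, k} : Finset (Fin n)) := by
      rw [← hpair]
      simp
    simpa [Finset.ne_of_mem_erase hj] using hmem
  · rintro ⟨s, hs⟩ his
    have his : i ∈ s := by simpa using his
    obtain ⟨j, hj⟩ := Finset.card_eq_one.mp
      (show (s.erase i).card = 1 by rw [Finset.card_erase_of_mem his, hs])
    have hmem : j ∈ s.erase i := by simp [hj]
    refine ⟨j, by simpa using Finset.ne_of_mem_erase hmem, Subtype.ext ?_⟩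
    change {i, j} = s
    rw [← hj, Finset.insert_erase his]
  · intro j hj
    rfl

/-- The sum over the pairs containing `i` of the total weight of the pair. -/
theorem sum_pairIdx_ite_mem_sum {n : ℕ} (x : Fin n → ℚ) (i : Fin n) :
    ∑ s : PairIdx n, (if i ∈ s.val then ∑ k ∈ s.val, x k else 0) =
      ((n : ℚ) - 2) * x i + ∑ k, x k := by
  rw [sum_pairIdx_ite_mem i (fun s => ∑ k ∈ s, x k)]
  have hpair : ∀ j ∈ Finset.univ.erase i, ∑ k ∈ ({i, j} : Finset (Fin n)), x k = x i + x j :=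
    fun j hj => Finset.sum_pair (Finset.ne_of_mem_erase hj).symm
  have hsum := Finset.add_sum_erase Finset.univ x (Finset.mem_univ i)
  have hn : 1 ≤ n := i.pos
  rw [Finset.sum_congr rfl hpair, Finset.sum_add_distrib, Finset.sum_const,
    Finset.card_erase_of_mem (Finset.mem_univ i), Finset.card_univ, Fintype.card_fin,
    nsmul_eq_mul, Nat.cast_sub hn, ← hsum]
  push_cast
  ring

theorem intersectionMatrix_inl_inl (g : ℤ) {n : ℕ} (i j : Fin n) :
    intersectionMatrix g n (Sum.inl i) (Sum.inl j) =
      (if i = j then 2 * (g : ℚ) + n - 4 else 0) + 1 := by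
  simp only [intersectionMatrix]
  split_ifs <;> ring

theorem intersectionMatrix_inr_inl (g : ℤ) {n : ℕ} (s : PairIdx n) (k : Fin n) :
    intersectionMatrix g n (Sum.inr s) (Sum.inl k) =
      (if k ∈ s.val then 4 * (g : ℚ) + n - 4 else 0) + 2 := by
  simp only [intersectionMatrix]
  split_ifs <;> ring

theorem intersectionMatrix_inr_inr (g : ℤ) {n : ℕ} (s t : PairIdx n) :
    intersectionMatrix g n (Sum.inr s) (Sum.inr t) =
      (if s = t then 2 * (g : ℚ) else 0) + ∑ k ∈ s.val, if k ∈ t.val then 1 else 0 := by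
  rw [← Finset.sum_filter, Finset.filter_mem_eq_inter, Finset.sum_const, nsmul_one]
  simp only [intersectionMatrix]
  by_cases hst : s = t
  · subst hst
    simp [s.2]
  · have hle : (s.val ∩ t.val).card ≤ 2 :=
      (Finset.card_le_card Finset.inter_subset_left).trans_eq s.2
    have hne : (s.val ∩ t.val).card ≠ 2 := by
      intro h
      have hs := Finset.eq_of_subset_of_card_le
        (Finset.inter_subset_left (s₁ := s.val) (s₂ := t.val)) (by rw [h, s.2])
      have ht := Finset.eq_of_subset_of_card_le
        (Finset.inter_subset_right (s₁ := s.val) (s₂ := t.val)) (by rw [h, t.2])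
      exact hst (Subtype.ext (hs.symm.trans ht))
    generalize (s.val ∩ t.val).card = c at hle hne
    interval_cases c <;> simp_all

theorem intersectionMatrix_mulVec_inl (g : ℤ) {n : ℕ} (v : Fin n ⊕ PairIdx n → ℚ) (i : Fin n) :
    (intersectionMatrix g n).mulVec v (Sum.inl i) =
      (2 * (g : ℚ) + n - 4) * v (Sum.inl i) + ∑ k, v (Sum.inl k) +
        ∑ s : PairIdx n, if i ∈ s.val then v (Sum.inr s) else 0 := by
  have hinr (s : PairIdx n) : intersectionMatrix g n (Sum.inl i) (Sum.inr s) =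
      if i ∈ s.val then 1 else 0 := rfl
  simp [Matrix.mulVec, dotProduct, Fintype.sum_sum_type, intersectionMatrix_inl_inl, hinr,
    add_mul, Finset.sum_add_distrib]

theorem intersectionMatrix_mulVec_inr (g : ℤ) {n : ℕ} (v : Fin n ⊕ PairIdx n → ℚ)
    (s : PairIdx n) :
    (intersectionMatrix g n).mulVec v (Sum.inr s) =
      (4 * (g : ℚ) + n - 4) * ∑ k ∈ s.val, v (Sum.inl k) + 2 * ∑ k, v (Sum.inl k) +
        (2 * (g : ℚ) * v (Sum.inr s) +
          ∑ k ∈ s.val, ∑ t : PairIdx n, if k ∈ t.val then v (Sum.inr t) else 0) := by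
  rw [Finset.sum_comm]
  simp only [Matrix.mulVec, dotProduct, Fintype.sum_sum_type, intersectionMatrix_inr_inl,
    intersectionMatrix_inr_inr, add_mul, Finset.sum_add_distrib, Finset.sum_mul, ite_mul,
    zero_mul, one_mul, Finset.sum_ite_eq, Finset.mem_univ, if_true, Finset.mul_sum,
    Finset.sum_ite_mem, Finset.univ_inter]

/-- For all integers `g ≥ 2` and `n ≥ 1`, the intersection matrix `M` is invertible
over `ℚ`, i.e. `det M ≠ 0`. -/
theorem intersectionMatrix_det_ne_zero (g : ℤ) (n : ℕ) (hg : 2 ≤ g) (hn : 1 ≤ n) :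
    (intersectionMatrix g n).det ≠ 0 := by
  rw [Ne, ← Matrix.exists_mulVec_eq_zero_iff]
  rintro ⟨v, hv, hMv⟩
  have hg' : (2 : ℚ) ≤ g := by exact_mod_cast hg
  have hinl (i : Fin n) := (intersectionMatrix_mulVec_inl g v i).symm.trans (congrFun hMv _)
  have hinr (s : PairIdx n) := (intersectionMatrix_mulVec_inr g v s).symm.trans (congrFun hMv _)
  simp only [Pi.zero_apply] at hinl hinr
  have hpair (s : PairIdx n) : v (Sum.inr s) = -∑ k ∈ s.val, v (Sum.inl k) := by
    have hsum := Finset.sum_eq_zero (s := s.val) fun i _ => hinl i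
    simp only [Finset.sum_add_distrib, ← Finset.mul_sum, Finset.sum_const, s.2,
      nsmul_eq_mul, Nat.cast_ofNat] at hsum
    have hmul : 2 * (g : ℚ) * (v (Sum.inr s) + ∑ k ∈ s.val, v (Sum.inl k)) = 0 := by
      linear_combination hinr s - hsum
    have := (mul_eq_zero.mp hmul).resolve_left (by linarith)
    linarith
  have hpoint (i : Fin n) : v (Sum.inl i) = 0 := by
    have hsum := sum_pairIdx_ite_mem_sum (fun k => v (Sum.inl k)) i
    have hi := hinl i
    have hneg : (∑ s : PairIdx n, if i ∈ s.val then v (Sum.inr s) else 0) =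
        -∑ s : PairIdx n, if i ∈ s.val then ∑ k ∈ s.val, v (Sum.inl k) else 0 := by
      rw [← Finset.sum_neg_distrib]
      refine Finset.sum_congr rfl fun s _ => ?_
      rw [hpair s]
      split_ifs <;> simp
    rw [hneg, hsum] at hi
    have hmul : (2 * (g : ℚ) - 2) * v (Sum.inl i) = 0 := by linear_combination hi
    exact (mul_eq_zero.mp hmul).resolve_left (by linarith)
  refine hv (funext ?_)
  rintro (i | s)
  · exact hpoint i
  · simp [hpair, hpoint]
end

section
/- For all integers g ≥ 2 and n ≥ 1 the following identities hold for the matrix M: (a) for all 1 ≤ i, j ≤ n one has M(T_i, ψ_j) − Σ_{l ≠ j} M(T_i, δ_{jl}) = (2g−2) if i = j and 0 otherwise (the sum is over the n−1 unordered pairs {j,l} with l ≠ j); (b) for all 1 ≤ i < j ≤ n and all 1 ≤ k ≤ n one has (M(T_{ij}, ψ_k) − M(T_i, ψ_k) − M(T_j, ψ_k)) − Σ_{l ≠ k} (M(T_{ij}, δ_{kl}) − M(T_i, δ_{kl}) − M(T_j, δ_{kl})) = 0; (c) for all unordered pairs {i,j} and {k,l} one has M(T_{ij}, δ_{kl}) −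 M(T_i, δ_{kl}) − M(T_j, δ_{kl}) = 2g if {i,j} = {k,l} and 0 otherwise. In particular, after replacing each row T_{ij} by T_{ij} − T_i − T_j and each column ψ_j by ψ_j − Σ_{l ≠ j} δ_{jl}, the matrix M becomes block upper triangular with diagonal blocks (2g−2)·Id_n and 2g·Id_{n(n−1)/2}. -/
open Finset

/-- A sum over the two-element subsets containing `j` is a sum over the other element. -/
theorem sum_pairIdx_mem {M : Type*} [AddCommMonoid M] {n : ℕ} (j : Fin n)
    (f : Finset (Fin n) → M) :
    ∑ s ∈ Finset.univ.filter (fun s : PairIdx n => j ∈ s.val), f s.val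
      = ∑ l ∈ Finset.univ.erase j, f {j, l} := by
  symm
  refine Finset.sum_bij
    (fun l hl => ⟨{j, l}, Finset.card_pair (Finset.ne_of_mem_erase hl).symm⟩) ?_ ?_ ?_ ?_
  · simp
  · intro a ha b hb hab
    have hmem : a ∈ ({j, b} : Finset (Fin n)) := by
      have hval : ({j, a} : Finset (Fin n)) = {j, b} := Subtype.ext_iff.mp hab
      simp [← hval]
    simpa [Finset.ne_of_mem_erase ha] using hmem
  · rintro ⟨s, hs⟩ hj
    obtain ⟨x, y, hxy, rfl⟩ := Finset.card_eq_two.mp hs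
    simp only [Finset.mem_filter, Finset.mem_univ, true_and, Finset.mem_insert,
      Finset.mem_singleton] at hj
    rcases hj with rfl | rfl
    · exact ⟨y, by simpa using hxy.symm, rfl⟩
    · exact ⟨x, by simpa using hxy, Subtype.ext (Finset.pair_comm _ _)⟩
  · simp

theorem sum_intersectionMatrix_inl_inr (g : ℤ) {n : ℕ} (i j : Fin n) :
    ∑ s ∈ Finset.univ.filter (fun s : PairIdx n => j ∈ s.val),
        intersectionMatrix g n (Sum.inl i) (Sum.inr s)
      = if i = j then (n : ℚ) - 1 else 1 := by
  simp only [intersectionMatrix]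
  rw [sum_pairIdx_mem j (fun s => if i ∈ s then (1 : ℚ) else 0)]
  split_ifs with h
  · subst h
    have hn : 1 ≤ n := i.pos
    simp [Finset.card_erase_of_mem, Nat.cast_sub hn]
  · simp [h]

theorem intersectionMatrix_row_op_inr (g : ℤ) {n : ℕ} {i j : Fin n} {s : PairIdx n}
    (hs : s.val = {i, j}) (t : PairIdx n) :
    intersectionMatrix g n (Sum.inr s) (Sum.inr t)
        - intersectionMatrix g n (Sum.inl i) (Sum.inr t)
        - intersectionMatrix g n (Sum.inl j) (Sum.inr t)
      = if s = t then 2 * (g : ℚ) else 0 := by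
  simp only [intersectionMatrix]
  by_cases hst : s = t
  · subst hst
    simp only [hs, if_true, Finset.mem_insert, Finset.mem_singleton, true_or, or_true]
    ring
  · have hnot : ¬ (i ∈ t.val ∧ j ∈ t.val) := fun ⟨hi, hj⟩ => hst <| Subtype.ext <|
      Finset.eq_of_subset_of_card_le
        (by simp [hs, Finset.insert_subset_iff, hi, hj]) (by rw [s.2, t.2])
    by_cases hi : i ∈ t.val <;> by_cases hj : j ∈ t.val <;>
      simp_all [Finset.insert_inter_of_mem, Finset.insert_inter_of_notMem]

/-- The change-of-basis identities making the intersection matrix block upper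
triangular with diagonal blocks `(2g-2)·Id` and `2g·Id`:
(a) `M(T_i, ψ_j) - ∑_{l ≠ j} M(T_i, δ_{jl})` is `2g-2` if `i = j` and `0` otherwise;
(b) the row operation `T_{ij} - T_i - T_j` followed by the column operation
`ψ_k - ∑_{l ≠ k} δ_{kl}` gives `0`;
(c) `M(T_{ij}, δ_{kl}) - M(T_i, δ_{kl}) - M(T_j, δ_{kl})` is `2g` if `{i,j} = {k,l}`
and `0` otherwise. -/
theorem intersectionMatrix_change_of_basis (g : ℤ) (n : ℕ) (hg : 2 ≤ g) (hn : 1 ≤ n) :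
    (∀ i j : Fin n,
        intersectionMatrix g n (Sum.inl i) (Sum.inl j)
          - ∑ s ∈ Finset.univ.filter (fun s : PairIdx n => j ∈ s.val),
              intersectionMatrix g n (Sum.inl i) (Sum.inr s)
        = if i = j then 2 * (g : ℚ) - 2 else 0)
    ∧ (∀ i j : Fin n, i ≠ j → ∀ s : PairIdx n, s.val = {i, j} → ∀ k : Fin n,
        (intersectionMatrix g n (Sum.inr s) (Sum.inl k)
            - intersectionMatrix g n (Sum.inl i) (Sum.inl k)
            - intersectionMatrix g n (Sum.inl j) (Sum.inl k))
          - ∑ t ∈ Finset.univ.filter (fun t : PairIdx n => k ∈ t.val),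
              (intersectionMatrix g n (Sum.inr s) (Sum.inr t)
                - intersectionMatrix g n (Sum.inl i) (Sum.inr t)
                - intersectionMatrix g n (Sum.inl j) (Sum.inr t))
        = 0)
    ∧ (∀ i j : Fin n, i ≠ j → ∀ s : PairIdx n, s.val = {i, j} → ∀ t : PairIdx n,
        intersectionMatrix g n (Sum.inr s) (Sum.inr t)
          - intersectionMatrix g n (Sum.inl i) (Sum.inr t)
          - intersectionMatrix g n (Sum.inl j) (Sum.inr t)
        = if s = t then 2 * (g : ℚ) else 0) := by
  refine ⟨fun i j => ?_, fun i j hij s hs k => ?_,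
    fun i j _ s hs t => intersectionMatrix_row_op_inr g hs t⟩
  · rw [sum_intersectionMatrix_inl_inr]
    simp only [intersectionMatrix]
    split_ifs <;> ring
  · simp only [intersectionMatrix_row_op_inr g hs, Finset.sum_ite_eq, Finset.mem_filter,
      Finset.mem_univ, true_and]
    simp only [intersectionMatrix, hs, Finset.mem_insert, Finset.mem_singleton]
    by_cases hik : k = i
    · subst hik
      simp only [true_or, if_true, if_neg hij.symm]
      ring
    · by_cases hjk : k = j
      · subst hjk
        simp only [or_true, if_true, if_neg hij]
        ring
      · simp only [hik, hjk, Ne.symm hik, Ne.symm hjk, or_self, if_false]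
        norm_num
end

section
/- Let g ≥ 2 be an integer. Then the ℚ-algebra homomorphism ℚ[c₁,c₂] → ℚ[t]/(t³) sending c₁ ↦ t and c₂ ↦ ((2g+1)/(2(g−1)))·t² kills R₁ and R₂ and induces a ℚ-algebra isomorphism ℚ[c₁,c₂]/(R₁, R₂) ≅ ℚ[t]/(t³). (This is the algebraic content of the computation of the rational Chow ring of the moduli space of irreducible, nodal hyperelliptic curves of genus g with no marked points: that ring is ℚ[δ]/(δ³), where δ = −(4g²+6g+2)c₁ is the class of the locus of singular curves.) -/
open Polynomial

/-- The coefficient ring `ℚ[c₁, c₂]`, the Chow ring of `BGL₂`. -/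
abbrev ChowBGL2 := MvPolynomial (Fin 2) ℚ

/-- The first Chern class `c₁` of the universal rank 2 bundle. -/
noncomputable def c₁ : ChowBGL2 := MvPolynomial.X 0

/-- The second Chern class `c₂` of the universal rank 2 bundle. -/
noncomputable def c₂ : ChowBGL2 := MvPolynomial.X 1

/-- The relation `R₁ = (8g³+12g²+4g)c₁² − (8g³−8g)c₂`, the pushforward to `BGL₂` of
`c₃(P²(O(2g+2)))`. -/
noncomputable def R₁ (g : ℤ) : ChowBGL2 :=
  ((8 * g ^ 3 + 12 * g ^ 2 + 4 * g : ℤ) : ChowBGL2) * c₁ ^ 2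
    - ((8 * g ^ 3 - 8 * g : ℤ) : ChowBGL2) * c₂

/-- The relation `R₂ = −(8g³+12g²+4g)c₁³ + (16g³+12g²−8g−4)c₁c₂`, the pushforward to
`BGL₂` of `z·c₃(P²(O(2g+2)))`. -/
noncomputable def R₂ (g : ℤ) : ChowBGL2 :=
  -((8 * g ^ 3 + 12 * g ^ 2 + 4 * g : ℤ) : ChowBGL2) * c₁ ^ 3
    + ((16 * g ^ 3 + 12 * g ^ 2 - 8 * g - 4 : ℤ) : ChowBGL2) * c₁ * c₂

/-- The truncated polynomial ring `ℚ[t]/(t³)`. -/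
abbrev TruncPoly := ℚ[X] ⧸ Ideal.span {(X : ℚ[X]) ^ 3}

/-- The image `t` of the variable in `ℚ[t]/(t³)`. -/
noncomputable def tbar : TruncPoly := Ideal.Quotient.mk _ X

/-- The `ℚ`-algebra homomorphism `ℚ[c₁,c₂] → ℚ[t]/(t³)` sending `c₁ ↦ t` and
`c₂ ↦ ((2g+1)/(2(g−1)))·t²`. -/
noncomputable def chowMap (g : ℤ) : ChowBGL2 →ₐ[ℚ] TruncPoly :=
  MvPolynomial.aeval
    (fun i : Fin 2 =>
      if i = 0 then tbar else ((2 * (g : ℚ) + 1) / (2 * ((g : ℚ) - 1))) • tbar ^ 2)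

lemma tbar_pow_three : tbar ^ 3 = 0 := by
  rw [tbar, ← map_pow]
  exact Ideal.Quotient.eq_zero_iff_mem.mpr (Ideal.mem_span_singleton_self _)

lemma chowMap_c₁ (g : ℤ) : chowMap g c₁ = tbar := by
  simp [chowMap, c₁]

lemma chowMap_c₂ (g : ℤ) :
    chowMap g c₂
      = algebraMap ℚ TruncPoly ((2 * (g : ℚ) + 1) / (2 * ((g : ℚ) - 1))) * tbar ^ 2 := by
  rw [chowMap, c₂, MvPolynomial.aeval_X, if_neg one_ne_zero]
  exact Algebra.smul_def (A := TruncPoly) _ _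

lemma chowMap_R₁ (g : ℤ) (hg : 2 ≤ g) : chowMap g (R₁ g) = 0 := by
  have hg' : (g : ℚ) - 1 ≠ 0 := by
    have : (2 : ℚ) ≤ g := by exact_mod_cast hg
    linarith
  have key : (8 * (g : ℚ) ^ 3 + 12 * g ^ 2 + 4 * g)
      - (8 * g ^ 3 - 8 * g) * ((2 * (g : ℚ) + 1) / (2 * ((g : ℚ) - 1))) = 0 := by
    field_simp
    ring
  have key' := congrArg (algebraMap ℚ TruncPoly) key
  simp only [R₁, map_sub, map_mul, map_pow, map_intCast, chowMap_c₁, chowMap_c₂]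
  simp only [map_sub, map_add, map_mul, map_pow, map_intCast, map_ofNat, map_zero] at key'
  push_cast
  linear_combination tbar ^ 2 * key'

lemma chowMap_R₂ (g : ℤ) : chowMap g (R₂ g) = 0 := by
  simp only [R₂, map_add, map_neg, map_mul, map_pow, map_intCast, chowMap_c₁, chowMap_c₂]
  linear_combination (-((8 * g ^ 3 + 12 * g ^ 2 + 4 * g : ℤ) : TruncPoly)
    + ((16 * g ^ 3 + 12 * g ^ 2 - 8 * g - 4 : ℤ) : TruncPoly)
      * algebraMap ℚ TruncPoly ((2 * (g : ℚ) + 1) / (2 * ((g : ℚ) - 1)))) * tbar_pow_three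

lemma c₂_sub_mem_span (g : ℤ) (hg : 2 ≤ g) :
    c₂ - MvPolynomial.C ((2 * (g : ℚ) + 1) / (2 * ((g : ℚ) - 1))) * c₁ ^ 2
      ∈ Ideal.span {R₁ g, R₂ g} := by
  have h2 : (2 : ℚ) ≤ g := by exact_mod_cast hg
  have h0 : (g : ℚ) ≠ 0 := by linarith
  have h1 : (g : ℚ) - 1 ≠ 0 := by linarith
  have h3 : (g : ℚ) + 1 ≠ 0 := by linarith
  set u : ℚ := -(1 / (8 * g * (g - 1) * (g + 1))) with hu
  have hA : u * (8 * (g : ℚ) ^ 3 + 12 * g ^ 2 + 4 * g)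
      = -((2 * (g : ℚ) + 1) / (2 * ((g : ℚ) - 1))) := by
    rw [hu]
    field_simp
    ring
  have hD : u * (8 * (g : ℚ) ^ 3 - 8 * g) = -1 := by
    rw [hu]
    field_simp
    ring
  have hA' := congrArg (MvPolynomial.C (σ := Fin 2)) hA
  have hD' := congrArg (MvPolynomial.C (σ := Fin 2)) hD
  simp only [map_sub, map_add, map_mul, map_pow, map_intCast, map_ofNat, map_neg, map_one]
    at hA' hD'
  refine Ideal.mem_span_pair.mpr ⟨MvPolynomial.C u, 0, ?_⟩
  rw [R₁]
  push_cast
  linear_combination c₁ ^ 2 * hA' - c₂ * hD'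

lemma c₁_pow_three_mem_span (g : ℤ) (hg : 2 ≤ g) :
    c₁ ^ 3 ∈ Ideal.span {R₁ g, R₂ g} := by
  have h2 : (2 : ℚ) ≤ g := by exact_mod_cast hg
  have h1 : (g : ℚ) - 1 ≠ 0 := by linarith
  set k : ℚ := (2 * (g : ℚ) + 1) / (2 * ((g : ℚ) - 1)) with hk
  set v : ℚ := -(8 * (g : ℚ) ^ 3 + 12 * g ^ 2 + 4 * g)
    + (16 * g ^ 3 + 12 * g ^ 2 - 8 * g - 4) * k with hv
  have hv0 : v ≠ 0 := by
    have h : v * (g - 1) = 2 * (2 * g + 1) * (g + 1) * ((2 * g - 1) * (g + 1)) := by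
      rw [hv, hk]
      field_simp
      ring
    have hpos : (0 : ℚ) < 2 * (2 * g + 1) * (g + 1) * ((2 * g - 1) * (g + 1)) := by
      have : (0 : ℚ) < 2 * g - 1 := by linarith
      positivity
    exact left_ne_zero_of_mul (h ▸ hpos.ne')
  have hmem : MvPolynomial.C v * c₁ ^ 3 ∈ Ideal.span {R₁ g, R₂ g} := by
    have hR₂ : R₂ g ∈ Ideal.span {R₁ g, R₂ g} := Ideal.subset_span (by simp)
    have hc := Ideal.mul_mem_left _
      (((16 * g ^ 3 + 12 * g ^ 2 - 8 * g - 4 : ℤ) : ChowBGL2) * c₁) (c₂_sub_mem_span g hg)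
    convert sub_mem hR₂ hc using 1
    rw [R₂, hv]
    simp only [map_sub, map_add, map_mul, map_pow, map_intCast, map_ofNat, map_neg]
    push_cast
    ring
  have := Ideal.mul_mem_left _ (MvPolynomial.C v⁻¹) hmem
  rwa [← mul_assoc, ← map_mul, inv_mul_cancel₀ hv0, map_one, one_mul] at this

/-- For `g ≥ 2`, the map `c₁ ↦ t`, `c₂ ↦ ((2g+1)/(2(g−1)))t²` kills `R₁` and `R₂` and
induces a `ℚ`-algebra isomorphism `ℚ[c₁,c₂]/(R₁,R₂) ≅ ℚ[t]/(t³)`. -/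
theorem chow_Igzero (g : ℤ) (hg : 2 ≤ g) :
    chowMap g (R₁ g) = 0 ∧ chowMap g (R₂ g) = 0 ∧
    ∃ e : (ChowBGL2 ⧸ Ideal.span {R₁ g, R₂ g}) ≃ₐ[ℚ] TruncPoly,
      ∀ p : ChowBGL2, e (Ideal.Quotient.mk (Ideal.span {R₁ g, R₂ g}) p) = chowMap g p := by
  have hker : ∀ p ∈ Ideal.span {R₁ g, R₂ g}, chowMap g p = 0 := by
    intro p hp
    obtain ⟨a, b, rfl⟩ := Ideal.mem_span_pair.mp hp
    simp [chowMap_R₁ g hg, chowMap_R₂ g]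
  have hcube : ∀ p ∈ Ideal.span {(X : ℚ[X]) ^ 3},
      aeval (Ideal.Quotient.mkₐ ℚ (Ideal.span {R₁ g, R₂ g}) c₁) p = 0 := by
    intro p hp
    obtain ⟨a, rfl⟩ := Ideal.mem_span_singleton.mp hp
    rw [map_mul, map_pow, aeval_X, ← map_pow, Ideal.Quotient.mkₐ_eq_mk,
      Ideal.Quotient.eq_zero_iff_mem.mpr (c₁_pow_three_mem_span g hg), zero_mul]
  let φ := Ideal.Quotient.liftₐ _ (chowMap g) hker
  let ψ := Ideal.Quotient.liftₐ _ _ hcube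
  have hφ : ∀ p, φ (Ideal.Quotient.mk _ p) = chowMap g p := fun _ => rfl
  have hψ : ψ tbar = Ideal.Quotient.mk _ c₁ := aeval_X _
  refine ⟨chowMap_R₁ g hg, chowMap_R₂ g, AlgEquiv.ofAlgHom φ ψ ?_ ?_, hφ⟩
  · apply Ideal.Quotient.algHom_ext
    apply Polynomial.algHom_ext
    change φ (ψ tbar) = tbar
    rw [hψ, hφ, chowMap_c₁]
  · apply Ideal.Quotient.algHom_ext
    apply MvPolynomial.algHom_ext
    intro i
    fin_cases i
    · change ψ (φ (Ideal.Quotient.mk _ c₁)) = Ideal.Quotient.mk _ c₁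
      rw [hφ, chowMap_c₁, hψ]
    · change ψ (φ (Ideal.Quotient.mk _ c₂)) = Ideal.Quotient.mk _ c₂
      rw [hφ, chowMap_c₂, map_mul, map_pow, hψ, AlgHom.commutes]
      have h := Ideal.Quotient.eq.mpr (c₂_sub_mem_span g hg)
      rw [h, map_mul, map_pow]
      rfl
end

section
/- Let k be an infinite field and g ≥ 2 an integer, and let V ⊂ k[X,Y] be the k-vector subspace of polynomials f with deg_X f ≤ g+1 and deg_Y f ≤ 2 (so dim_k V = 3g+6). Then for every integer N with g ≤ N ≤ 3g+5 there exist points p₁, …, p_N ∈ k² with pairwise distinct first coordinates, such that p₁, …, p_g all have the same second coordinate, and such that the evaluation map V → k^N, f ↦ (f(p₁), …, f(p_N)), is surjective. (This is the paper's lemma that a general collection of N ≤ 3g+5 points on ℙ¹ × ℙ¹, with g of them on the same line of the ruling, imposes independent conditions on the linear system O(g+1, 2); it is the key input for the rationality of the moduli space of n-pointed hyperelliptic curves of genus g for n ≤ 3g+6.) -/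
open MvPolynomial in
/-- A product of `#s` linear forms `X i - c` has degree at most `#s` in `X i`
and degree zero in every other variable. -/
lemma degreeOf_prod_X_sub_C_le {σ ι k : Type*} [DecidableEq σ] [Field k] (s : Finset ι) (c : ι → k)
    (i j : σ) :
    degreeOf j (∏ b ∈ s, (X i - C (c b) : MvPolynomial σ k)) ≤ if j = i then s.card else 0 := by
  classical
  refine (degreeOf_prod_le j s _).trans ?_
  have h : ∀ b ∈ s, degreeOf j (X i - C (c b) : MvPolynomial σ k) ≤ if j = i then 1 else 0 := by
    intro b _
    refine (degreeOf_sub_le _ _ _).trans ?_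
    simp [degreeOf_X, degreeOf_C]
  refine (Finset.sum_le_sum h).trans ?_
  split_ifs <;> simp

open MvPolynomial in
/-- If the fibres of `q` have at most `m + 1` elements and `x`, `y` are injective, then the points
`(x a, y (q a))` impose independent conditions on polynomials of bidegree at most `(m, n)`, where
the target of `q` has `n + 1` elements. -/
lemma exists_eval_eq_of_fibres {k ι : Type*} [Field k] [Fintype ι] [DecidableEq ι] {m n : ℕ}
    (q : ι → Fin (n + 1)) (hq : ∀ j, (Finset.univ.filter fun b => q b = j).card ≤ m + 1)
    {x : ι → k} (hx : Function.Injective x) {y : Fin (n + 1) → k} (hy : Function.Injective y)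
    (v : ι → k) :
    ∃ f : MvPolynomial (Fin 2) k, f.degreeOf 0 ≤ m ∧ f.degreeOf 1 ≤ n ∧
      ∀ a, eval (fun i : Fin 2 => if i = 0 then x a else y (q a)) f = v a := by
  let S : ι → Finset ι := fun a => (Finset.univ.filter fun b => q b = q a).erase a
  let T : ι → Finset (Fin (n + 1)) := fun a => Finset.univ.erase (q a)
  have hS : ∀ a, (S a).card ≤ m := fun a => by
    have h : (S a).card = _ := Finset.card_erase_of_mem (by simp)
    have := hq (q a)
    omega
  have hT : ∀ a, (T a).card = n := fun a => by simp [T]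
  let F : ι → MvPolynomial (Fin 2) k := fun a =>
    (∏ b ∈ S a, (X 0 - C (x b))) * ∏ j ∈ T a, (X 1 - C (y j))
  let P : ι → Fin 2 → k := fun a i => if i = 0 then x a else y (q a)
  have hF : ∀ a b, eval (P b) (F a) = (∏ c ∈ S a, (x b - x c)) * ∏ j ∈ T a, (y (q b) - y j) :=
    fun a b => by simp [F, P]
  have hne : ∀ a, eval (P a) (F a) ≠ 0 := fun a => by
    rw [hF]
    refine mul_ne_zero (Finset.prod_ne_zero_iff.2 fun c hc => ?_)
      (Finset.prod_ne_zero_iff.2 fun j hj => ?_)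
    · exact sub_ne_zero.2 (hx.ne (Finset.ne_of_mem_erase hc).symm)
    · exact sub_ne_zero.2 (hy.ne (Finset.ne_of_mem_erase hj).symm)
  have hzero : ∀ a b, a ≠ b → eval (P b) (F a) = 0 := fun a b hab => by
    rw [hF]
    by_cases h : q b = q a
    · exact mul_eq_zero_of_left (Finset.prod_eq_zero (i := b)
        (by simp [S, h, hab.symm]) (sub_self _)) _
    · exact mul_eq_zero_of_right _ (Finset.prod_eq_zero (i := q b)
        (by simp [T, h]) (sub_self _))
  have hdeg : ∀ (i : Fin 2) (d : ℕ), (∀ a, degreeOf i (F a) ≤ d) →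
      degreeOf i (∑ a, C (v a / eval (P a) (F a)) * F a) ≤ d := fun i d h =>
    (degreeOf_sum_le _ _ _).trans (Finset.sup_le fun a _ => (degreeOf_C_mul_le _ _ _).trans (h a))
  refine ⟨∑ a, C (v a / eval (P a) (F a)) * F a, hdeg 0 m fun a => ?_, hdeg 1 n fun a => ?_,
    fun a => ?_⟩
  · refine (degreeOf_mul_le _ _ _).trans ((add_le_add (degreeOf_prod_X_sub_C_le _ _ _ _)
      (degreeOf_prod_X_sub_C_le _ _ _ _)).trans ?_)
    simpa using hS a
  · refine (degreeOf_mul_le _ _ _).trans ((add_le_add (degreeOf_prod_X_sub_C_le _ _ _ _)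
      (degreeOf_prod_X_sub_C_le _ _ _ _)).trans ?_)
    simp [hT a]
  · change eval (P a) _ = v a
    rw [map_sum, Finset.sum_eq_single a]
    · simp [hne a]
    · intro b _ hba
      simp [hzero b a hba]
    · simp

/-- The fibres of `b ↦ b / d` on `Fin N` have at most `d` elements. -/
lemma card_filter_div_eq_le {N d : ℕ} (hd : 0 < d) (j : ℕ) :
    (Finset.univ.filter fun b : Fin N => (b : ℕ) / d = j).card ≤ d := by
  have hmem : ∀ b ∈ Finset.univ.filter (fun b : Fin N => (b : ℕ) / d = j),
      (b : ℕ) % d ∈ Finset.range d := fun b _ => Finset.mem_range.2 (Nat.mod_lt _ hd)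
  refine (Finset.card_le_card_of_injOn _ hmem ?_).trans_eq (Finset.card_range _)
  intro a ha b hb hab
  have ha' : (a : ℕ) / d = j := by simpa using ha
  have hb' : (b : ℕ) / d = j := by simpa using hb
  have hmod : (a : ℕ) % d = (b : ℕ) % d := hab
  apply Fin.ext
  rw [← Nat.div_add_mod (a : ℕ) d, ha', hmod, ← hb', Nat.div_add_mod]

/-- Let `k` be an infinite field and `g ≥ 2`. For every `N` with `g ≤ N ≤ 3g+5` there
exist points `p₁, …, p_N ∈ k²` with pairwise distinct first coordinates, the first `g`
of which share the same second coordinate, such that evaluation at these points is a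
surjective map from the space of polynomials of bidegree at most `(g+1, 2)` to `k^N`
(i.e., the points impose independent conditions on `O(g+1, 2)` on `ℙ¹ × ℙ¹`). -/
theorem general_points_impose_independent_conditions
    (k : Type*) [Field k] [Infinite k] (g : ℕ) (hg : 2 ≤ g)
    (N : ℕ) (hN₁ : g ≤ N) (hN₂ : N ≤ 3 * g + 5) :
    ∃ p : Fin N → k × k,
      (Function.Injective fun a : Fin N => (p a).1) ∧
      (∀ a b : Fin N, (a : ℕ) < g → (b : ℕ) < g → (p a).2 = (p b).2) ∧
      (∀ v : Fin N → k, ∃ f : MvPolynomial (Fin 2) k,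
        f.degreeOf 0 ≤ g + 1 ∧ f.degreeOf 1 ≤ 2 ∧
        ∀ a : Fin N, MvPolynomial.eval (fun i : Fin 2 => if i = 0 then (p a).1 else (p a).2) f
          = v a) := by
  have hlt : ∀ a : Fin N, (a : ℕ) / (g + 2) < 2 + 1 := fun a => by
    rw [Nat.div_lt_iff_lt_mul (by omega)]
    have := a.isLt
    omega
  obtain ⟨q, hq⟩ : ∃ q : Fin N → Fin (2 + 1), ∀ a, (q a : ℕ) = (a : ℕ) / (g + 2) :=
    ⟨fun a => ⟨(a : ℕ) / (g + 2), hlt a⟩, fun _ => rfl⟩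
  obtain ⟨e, he⟩ : ∃ e : ℕ → k, Function.Injective e := ⟨_, (Infinite.natEmbedding k).injective⟩
  have hx : Function.Injective fun a : Fin N => e a := fun a b h => Fin.ext (he h)
  have hy : Function.Injective fun j : Fin (2 + 1) => e j := fun a b h => Fin.ext (he h)
  have hcard : ∀ j, (Finset.univ.filter fun b => q b = j).card ≤ (g + 1) + 1 := fun j => by
    simpa only [Fin.ext_iff, hq] using card_filter_div_eq_le (N := N) (Nat.succ_pos (g + 1)) (j : ℕ)
  refine ⟨fun a => (e a, e (q a)), hx, fun a b ha hb => ?_, fun v => ?_⟩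
  · change e (q a) = e (q b)
    rw [hq, hq, Nat.div_eq_of_lt (by omega), Nat.div_eq_of_lt (by omega)]
  · obtain ⟨f, hf₀, hf₁, hf⟩ := exists_eval_eq_of_fibres (m := g + 1) (n := 2) q hcard hx hy v
    exact ⟨f, hf₀, hf₁, hf⟩
end
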